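/- For every x in the interval [1/3, 1/2] and every y in the interval [φ, 2φ], it holds that P(1 − φ) + Q(1 − x) + (x + φ − 1)·ξ(x) + max{T(x,y), 0} ≥ R. -/

import Mathlib

open Real

noncomputable def R : ℝ := 1 / (1 + Real.log 2)

noncomputable def f (x : ℝ) : ℝ :=
  if x ≤ R then 1/2 else (2 * Real.exp 1) ^ (x - 1)

noncomputable def F (x : ℝ) : ℝ :=
  if x ≤ R then x/2 else R * (2 * Real.exp 1) ^ (x - 1)

noncomputable def P (c : ℝ) : ℝ := ∫ y in (0:ℝ)..1, min (f y) c

noncomputable def Q (c : ℝ) : ℝ := ∫ y in (0:ℝ)..1, max (c - f y) 0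

noncomputable def xic : ℝ := (1 + (2/3) * Real.log (4/3)) * R - 2/3

noncomputable def phi : ℝ := (2/3) * xic / (2/3 - R + xic)

noncomputable def xi (x : ℝ) : ℝ :=
  if x ≤ 1/3 then xic / x else 9 * xic * (1 - 2 * x)

noncomputable def T (a b : ℝ) : ℝ := (a + b - 1/2) * (xi b - xi a)

noncomputable def pile (x : ℝ) : ℝ := max (2/3) (2 * x)

theorem zero_lt_log_two : 0 < Real.log 2 := Real.log_pos one_lt_two

theorem R_pos : 0 < R := by
  unfold R
  have := zero_lt_log_two
  positivity

theorem R_mul_one_add_log_two : R * (1 + Real.log 2) = 1 := by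
  unfold R
  have := zero_lt_log_two
  field_simp

theorem R_lower : 0.59061 ≤ R := by
  nlinarith [R_mul_one_add_log_two, R_pos, Real.log_two_lt_d9]

theorem R_upper : R ≤ 0.59062 := by
  nlinarith [R_mul_one_add_log_two, R_pos, Real.log_two_gt_d9]

theorem log_four_thirds_bounds :
    0.287682 ≤ Real.log (4/3) ∧ Real.log (4/3) ≤ 0.287683 := by
  have h := Real.abs_log_sub_add_sum_range_le (x := (1/4 : ℝ)) (by norm_num [abs_lt]) 12
  have hl : Real.log (4/3) = -Real.log (1 - 1/4) := by
    rw [← Real.log_inv]; norm_num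
  rw [hl]
  rw [abs_le] at h
  norm_num [Finset.sum_range_succ, abs_of_pos] at h ⊢
  constructor <;> linarith [h.1, h.2]

theorem xic_lower : 0.037214 ≤ xic := by
  unfold xic
  nlinarith [log_four_thirds_bounds.1, R_lower]

theorem xic_upper : xic ≤ 0.03723 := by
  unfold xic
  nlinarith [log_four_thirds_bounds.2, R_lower, R_upper]

theorem phi_lower : 0.219 ≤ phi := by
  unfold phi
  have := R_upper
  have := R_lower
  have := xic_lower
  rw [le_div_iff₀ (by linarith)]
  linarith

theorem phi_upper : phi ≤ 0.2192 := by
  unfold phi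
  have := R_upper
  have := xic_upper
  have := xic_lower
  rw [div_le_iff₀ (by linarith)]
  linarith

theorem f_of_R_le {x : ℝ} (hx : R ≤ x) : f x = Real.exp ((x - 1) / R) := by
  have hpow : (2 * Real.exp 1) ^ (x - 1) = Real.exp ((x - 1) / R) := by
    rw [Real.rpow_def_of_pos (by positivity), Real.log_mul (by norm_num) (Real.exp_pos 1).ne',
      Real.log_exp]
    congr 1
    unfold R
    have := zero_lt_log_two
    field_simp
    ring
  rcases hx.eq_or_lt with rfl | hx
  · have h : (R - 1) / R = -Real.log 2 := by
      have := R_pos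
      field_simp
      linarith [R_mul_one_add_log_two]
    rw [f, if_pos le_rfl, h, Real.exp_neg, Real.exp_log two_pos]
    norm_num
  · rw [f, if_neg hx.not_ge, hpow]

theorem f_eq (x : ℝ) : f x = Real.exp ((max x R - 1) / R) := by
  rcases le_total x R with hx | hx
  · rw [max_eq_right hx, ← f_of_R_le le_rfl, f, f, if_pos hx, if_pos le_rfl]
  · rw [max_eq_left hx, f_of_R_le hx]

theorem f_of_le_R {x : ℝ} (hx : x ≤ R) : f x = 1/2 := if_pos hx

theorem continuous_f : Continuous f := by
  rw [funext f_eq]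
  fun_prop

theorem P_eq {c : ℝ} (hc : 1/2 ≤ c) (hc1 : c ≤ 1) : P c = R * (c - c * Real.log c) := by
  have hR := R_pos
  have hc0 : 0 < c := by linarith
  have hlog : -Real.log 2 ≤ Real.log c := by
    rw [← Real.log_inv]
    exact Real.log_le_log (by norm_num) (by linarith)
  have hlog0 : Real.log c ≤ 0 := Real.log_nonpos hc0.le hc1
  set b := 1 + R * Real.log c with hb
  have hRb : R ≤ b := by nlinarith [R_mul_one_add_log_two]
  have hb1 : b ≤ 1 := by nlinarith
  have hint (u v : ℝ) : IntervalIntegrable (fun y => min (f y) c) MeasureTheory.volume u v :=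
    (continuous_f.min continuous_const).intervalIntegrable u v
  have h₁ : ∫ y in (0:ℝ)..R, min (f y) c = R / 2 := by
    rw [intervalIntegral.integral_congr (g := fun _ => 1/2)]
    · simp; ring
    · intro y hy
      rw [Set.uIcc_of_le hR.le] at hy
      simp only [f_of_le_R hy.2, min_eq_left hc]
  have h₂ : ∫ y in R..b, min (f y) c = R * c - R / 2 := by
    rw [intervalIntegral.integral_congr (g := fun y => Real.exp ((y - 1) / R))]
    · have hderiv (y : ℝ) : HasDerivAt (fun y => R * Real.exp ((y - 1) / R))
          (Real.exp ((y - 1) / R)) y := by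
        have h := ((((hasDerivAt_id' y).sub_const 1).div_const R).exp).const_mul R
        rwa [mul_left_comm, mul_one_div_cancel hR.ne', mul_one] at h
      rw [intervalIntegral.integral_eq_sub_of_hasDerivAt (fun y _ => hderiv y)
        (Continuous.intervalIntegrable (by fun_prop) _ _), ← f_of_R_le le_rfl, f_of_le_R le_rfl]
      have : (b - 1) / R = Real.log c := by rw [hb]; field_simp; ring
      rw [this, Real.exp_log hc0]
      ring
    · intro y hy
      rw [Set.uIcc_of_le hRb] at hy
      simp only [f_of_R_le hy.1]
      apply min_eq_left
      rw [← Real.le_log_iff_exp_le hc0, div_le_iff₀ hR]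
      linarith [hy.2]
  have h₃ : ∫ y in b..(1:ℝ), min (f y) c = c * (1 - b) := by
    rw [intervalIntegral.integral_congr (g := fun _ => c)]
    · simp; ring
    · intro y hy
      rw [Set.uIcc_of_le hb1] at hy
      simp only [f_of_R_le (hRb.trans hy.1)]
      apply min_eq_right
      rw [← Real.log_le_iff_le_exp hc0, le_div_iff₀ hR]
      linarith [hy.1]
  rw [P, ← intervalIntegral.integral_add_adjacent_intervals (hint 0 R) (hint R 1),
    ← intervalIntegral.integral_add_adjacent_intervals (hint R b) (hint b 1), h₁, h₂, h₃, hb]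
  ring

theorem Q_ge {c : ℝ} (hc : 1/2 ≤ c) : R * (c - 1/2) ≤ Q c := by
  have hR := R_pos
  have hR1 : R ≤ 1 := by linarith [R_upper]
  have hint (u v : ℝ) : IntervalIntegrable (fun y => max (c - f y) 0) MeasureTheory.volume u v :=
    ((continuous_const.sub continuous_f).max continuous_const).intervalIntegrable u v
  have h₁ : ∫ y in (0:ℝ)..R, max (c - f y) 0 = R * (c - 1/2) := by
    rw [intervalIntegral.integral_congr (g := fun _ => c - 1/2)]
    · simp; ring
    · intro y hy
      rw [Set.uIcc_of_le hR.le] at hy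
      simp only [f_of_le_R hy.2]
      exact max_eq_left (by linarith)
  have h₂ : 0 ≤ ∫ y in R..(1:ℝ), max (c - f y) 0 :=
    intervalIntegral.integral_nonneg hR1 fun y _ => le_max_right _ _
  rw [Q, ← intervalIntegral.integral_add_adjacent_intervals (hint 0 R) (hint R 1), h₁]
  linarith

theorem cubic_le_neg_log {x : ℝ} (h0 : 0 ≤ x) (h1 : x < 1) :
    x + x ^ 2 / 2 + x ^ 3 / 3 ≤ -Real.log (1 - x) := by
  have h := sum_le_hasSum (Finset.range 3) (fun i _ => by positivity)
    (Real.hasSum_pow_div_log_of_abs_lt_one (abs_lt.2 ⟨by linarith, h1⟩))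
  norm_num [Finset.sum_range_succ] at h
  linarith

theorem P_one_sub_phi_ge : R - 0.016 ≤ P (1 - phi) := by
  have h1 := phi_lower
  have h2 := phi_upper
  rw [P_eq (by linarith) (by linarith)]
  have hlog := cubic_le_neg_log (x := phi) (by linarith) (by linarith)
  have hmul := mul_le_mul_of_nonneg_left hlog (by linarith : 0 ≤ 1 - phi)
  have hsq : phi ^ 2 ≤ 0.2192 ^ 2 := by gcongr
  have hcube : phi ^ 3 ≤ 0.2192 ^ 3 := by gcongr
  have hfour : phi ^ 4 ≤ 0.2192 ^ 4 := by gcongr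
  have key : 1 - 0.027 ≤ (1 - phi) - (1 - phi) * Real.log (1 - phi) := by
    nlinarith
  nlinarith [R_pos, R_upper]

theorem xi_of_third_le {x : ℝ} (hx : 1/3 ≤ x) : xi x = 9 * xic * (1 - 2 * x) := by
  rcases hx.eq_or_lt with rfl | hx
  · rw [xi, if_pos le_rfl]; ring
  · rw [xi, if_neg hx.not_ge]

theorem T_ge_of_le_third {x y : ℝ} (hx : 0.45 ≤ x) (hx' : x ≤ 1/2) (hy : phi ≤ y)
    (hy' : y ≤ 1/3) : 0.016 ≤ T x y := by
  have hφ := phi_lower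
  have hy0 : 0 < y := by linarith
  have hinv : 1 / y + 18 * y ≤ 9 := by
    have : 1 / y ≤ 9 - 18 * y := by
      rw [div_le_iff₀ hy0]
      nlinarith
    linarith
  have hT : T x y = xic * (1 - (1/2 - x) * (1 / y + 18 * y) + 18 * (1/2 - x) ^ 2) := by
    rw [T, xi_of_third_le (x := x) (by linarith), xi, if_pos hy']
    field_simp
    ring
  have : 0.55 ≤ 1 - (1/2 - x) * (1 / y + 18 * y) + 18 * (1/2 - x) ^ 2 := by
    nlinarith [sq_nonneg (1/2 - x)]
  rw [hT]
  nlinarith [xic_lower]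

theorem stmt_15 : ∀ x ∈ Set.Icc (1/3 : ℝ) (1/2), ∀ y ∈ Set.Icc phi (2 * phi),
    P (1 - phi) + Q (1 - x) + (x + phi - 1) * xi x + max (T x y) 0 ≥ R := by
  rintro x ⟨hx, hx'⟩ y ⟨hy, hy'⟩
  have hP := P_one_sub_phi_ge
  have hQ := Q_ge (c := 1 - x) (by linarith)
  have hφ := phi_lower
  have hφ' := phi_upper
  have hξ := xic_lower
  have hξ' := xic_upper
  have hR := R_lower
  have hT := le_max_left (T x y) 0
  have hT0 := le_max_right (T x y) 0
  obtain ⟨t, rfl⟩ : ∃ t, x = 1/2 - t := ⟨1/2 - x, by ring⟩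
  have ht : 0 ≤ t := by linarith
  have hQt : 0.59061 * t ≤ Q (1 - (1/2 - t)) := by nlinarith
  have hxi : -(t * 0.67014 * (0.281 + t)) ≤ (1/2 - t + phi - 1) * xi (1/2 - t) := by
    rw [xi_of_third_le hx]
    have h : xic * (1/2 - phi + t) ≤ 0.03723 * (0.281 + t) := by
      gcongr
      · linarith
      · linarith
    nlinarith [mul_le_mul_of_nonneg_left h ht]
  rcases le_total 0.05 t with ht5 | ht5
  · nlinarith
  rcases le_total y (1/3) with hy3 | hy3
  · have := T_ge_of_le_third (x := 1/2 - t) (by linarith) hx' hy hy3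
    nlinarith
  · have hTy : 0.669852 * ((y - t) * (1/2 - t - y)) ≤ T (1/2 - t) y := by
      have hT_eq : T (1/2 - t) y = 18 * xic * ((y - t) * (1/2 - t - y)) := by
        rw [T, xi_of_third_le hx, xi_of_third_le hy3]
        ring
      rw [hT_eq]
      have : 0 ≤ (y - t) * (1/2 - t - y) := mul_nonneg (by linarith) (by linarith)
      nlinarith
    have hmono : (0.4384 - t) * (0.0616 - t) ≤ (y - t) * (1/2 - t - y) := by
      nlinarith
    nlinarith
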